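/- Assume Assumption A2. Then for every n ∈ ℕ, every integer m ≥ 1, every pair of nodes p, q ∈ N_h, and i ∈ {1,2}, the even-order partial derivative ∂_i^{2n}ψ_{p,m} extends continuously to the closure of Ω; moreover (κ^{−1}∂₁)^{2n}ψ_{p,m}(q) = −δ_{pq}·(−1)^{n+m}·ν̃_m^{2n}, where ν̃_m := (2m−1)π/(2κh₁) and δ_{pq} is the Kronecker delta. -/

import Mathlib

open MeasureTheory Real Set
open scoped Real Classical ENNReal NNReal

noncomputable section

/-- Partial derivative in the first coordinate. -/
def pd1 (f : ℝ × ℝ → ℂ) : ℝ × ℝ → ℂ := fun x => deriv (fun t => f (t, x.2)) x.1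

/-- Partial derivative in the second coordinate. -/
def pd2 (f : ℝ × ℝ → ℂ) : ℝ × ℝ → ℂ := fun x => deriv (fun t => f (x.1, t)) x.2

/-- Mixed partial derivative `∂₁^i ∂₂^j`. -/
def pdM (i j : ℕ) (f : ℝ × ℝ → ℂ) : ℝ × ℝ → ℂ := pd1^[i] (pd2^[j] f)

/-- Multi-indices of order at most `M`. -/
def idxLe (M : ℕ) : Finset (ℕ × ℕ) :=
  (Finset.range (M + 1) ×ˢ Finset.range (M + 1)).filter fun p => p.1 + p.2 ≤ M

/-- κ-weighted Sobolev inner product of order `M` on `D`. -/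
def sobInner (κ : ℝ) (M : ℕ) (D : Set (ℝ × ℝ)) (f g : ℝ × ℝ → ℂ) : ℂ :=
  ∑ p ∈ idxLe M, ((κ : ℂ) ^ (2 * (p.1 + p.2)))⁻¹ *
    ∫ x in D, pdM p.1 p.2 f x * (starRingEnd ℂ) (pdM p.1 p.2 g x)

/-- Square of the κ-weighted Sobolev norm of order `M` on `D`. -/
def sobNormSq (κ : ℝ) (M : ℕ) (D : Set (ℝ × ℝ)) (f : ℝ × ℝ → ℂ) : ℝ :=
  ∑ p ∈ idxLe M, (κ ^ (2 * (p.1 + p.2)))⁻¹ * ∫ x in D, ‖pdM p.1 p.2 f x‖ ^ 2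

/-- κ-weighted Sobolev norm of order `M` on `D`. -/
def sobNorm (κ : ℝ) (M : ℕ) (D : Set (ℝ × ℝ)) (f : ℝ × ℝ → ℂ) : ℝ :=
  Real.sqrt (sobNormSq κ M D f)

/-- Membership in `H^M_κ(D)` (for pointwise-differentiable representatives). -/
def MemSob (M : ℕ) (D : Set (ℝ × ℝ)) (f : ℝ × ℝ → ℂ) : Prop :=
  ∀ p ∈ idxLe M, IntegrableOn (fun x => ‖pdM p.1 p.2 f x‖ ^ 2) D

/-- `ν̂_n = nπ/(κ ĥ₁)`. -/
def nuHat (κ h1 : ℝ) (n : ℕ) : ℝ := n * π / (κ * h1)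

/-- Principal complex square root of a real number. -/
def csqrt (r : ℝ) : ℂ := (r : ℂ) ^ (1 / 2 : ℂ)

/-- The single-edge Helmholtz mode `φ̂_n` on the reference rectangle. -/
def phiHat (κ h1 h2 : ℝ) (n : ℕ) : ℝ × ℝ → ℂ := fun x =>
  Complex.sin (↑(κ * nuHat κ h1 n) * (x.1 : ℂ)) *
    Complex.sin ((x.2 : ℂ) * (κ : ℂ) * csqrt (1 - nuHat κ h1 n ^ 2)) /
    Complex.sin ((h2 : ℂ) * (κ : ℂ) * csqrt (1 - nuHat κ h1 n ^ 2))

/-- The open reference rectangle `K̂ = (0,ĥ₁) × (0,ĥ₂)`. -/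
def Khat (h1 h2 : ℝ) : Set (ℝ × ℝ) := Ioo 0 h1 ×ˢ Ioo 0 h2

/-- Assumption A0: `κ²` is not a Δ-Neumann eigenvalue of the rectangle with sides `h1, h2`. -/
def A0cond (κ h1 h2 : ℝ) : Prop :=
  ∀ n m : ℕ, κ ^ 2 ≠ (n * π / h1) ^ 2 + (m * π / h2) ^ 2

/-- Distributional (weak) solution of the homogeneous Helmholtz equation on `D`. -/
def WeakHelmholtz (κ : ℝ) (D : Set (ℝ × ℝ)) (u : ℝ × ℝ → ℂ) : Prop :=
  IntegrableOn u D ∧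
  ∀ φ : ℝ × ℝ → ℂ, ContDiff ℝ (⊤ : ℕ∞) φ → HasCompactSupport φ → tsupport φ ⊆ D →
    ∫ x in D, u x * (pdM 2 0 φ x + pdM 0 2 φ x + (κ : ℂ) ^ 2 * φ x) = 0

/-- The trace of `u` on the top edge (at height `h2`). -/
def traceTop (h2 : ℝ) (u : ℝ × ℝ → ℂ) : ℝ → ℂ := fun t => u (t, h2)

/-- The class `S^{N,M}_κ(K̂, ŝ)` of Helmholtz solutions with trace supported on the top edge. -/
structure SLoc (κ h1 h2 : ℝ) (N M : ℕ) (u : ℝ × ℝ → ℂ) : Prop where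
  cont : ContinuousOn u (Icc 0 h1 ×ˢ Icc 0 h2)
  mem : MemSob 1 (Khat h1 h2) u
  helm : WeakHelmholtz κ (Khat h1 h2) u
  left : ∀ y ∈ Icc (0 : ℝ) h2, u (0, y) = 0
  right : ∀ y ∈ Icc (0 : ℝ) h2, u (h1, y) = 0
  bottom : ∀ x ∈ Icc (0 : ℝ) h1, u (x, 0) = 0
  traceReg : ContDiffOn ℝ M (traceTop h2 u) (Icc 0 h1)
  endpt0 : ∀ j < N, iteratedDerivWithin (2 * j) (traceTop h2 u) (Icc 0 h1) 0 = 0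
  endpt1 : ∀ j < N, iteratedDerivWithin (2 * j) (traceTop h2 u) (Icc 0 h1) h1 = 0

/-- Square of the trace seminorm `|u|_{H^M_κ(ŝ)}`. -/
def traceSemiSq (κ h1 h2 : ℝ) (M : ℕ) (u : ℝ × ℝ → ℂ) : ℝ :=
  (κ ^ (2 * M))⁻¹ * ∫ t in (0 : ℝ)..h1, ‖iteratedDerivWithin M (traceTop h2 u) (Icc 0 h1) t‖ ^ 2

/-- The `L²(ŝ)` inner product of traces on the top edge. -/
def traceL2Inner (h1 h2 : ℝ) (u v : ℝ × ℝ → ℂ) : ℂ :=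
  ∫ t in (0 : ℝ)..h1, u (t, h2) * (starRingEnd ℂ) (v (t, h2))

/-- The squared `L²(ŝ)` norm of the trace on the top edge. -/
def traceL2Sq (h1 h2 : ℝ) (u : ℝ × ℝ → ℂ) : ℝ :=
  ∫ t in (0 : ℝ)..h1, ‖u (t, h2)‖ ^ 2


/-! ### Cartesian mesh machinery -/

/-- The open cell of the Cartesian grid indexed by `c ∈ ℤ²`. -/
def cellO (h1 h2 : ℝ) (c : ℤ × ℤ) : Set (ℝ × ℝ) :=
  Ioo ((c.1 : ℝ) * h1) (((c.1 : ℝ) + 1) * h1) ×ˢ Ioo ((c.2 : ℝ) * h2) (((c.2 : ℝ) + 1) * h2)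

/-- The closed cell of the Cartesian grid indexed by `c ∈ ℤ²`. -/
def cellC (h1 h2 : ℝ) (c : ℤ × ℤ) : Set (ℝ × ℝ) :=
  Icc ((c.1 : ℝ) * h1) (((c.1 : ℝ) + 1) * h1) ×ˢ Icc ((c.2 : ℝ) * h2) (((c.2 : ℝ) + 1) * h2)

/-- Horizontal edges of the mesh: `(i,j)` corresponds to `[i h₁,(i+1)h₁] × {j h₂}`. -/
def hEdges (cells : Finset (ℤ × ℤ)) : Finset (ℤ × ℤ) :=
  cells ∪ cells.image fun c => (c.1, c.2 + 1)

/-- Vertical edges of the mesh: `(i,j)` corresponds to `{i h₁} × [j h₂,(j+1)h₂]`. -/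
def vEdges (cells : Finset (ℤ × ℤ)) : Finset (ℤ × ℤ) :=
  cells ∪ cells.image fun c => (c.1 + 1, c.2)

/-- Nodes of the mesh: `(i,j)` corresponds to the point `(i h₁, j h₂)`. -/
def meshNodes (cells : Finset (ℤ × ℤ)) : Finset (ℤ × ℤ) :=
  ((cells ∪ cells.image fun c => (c.1 + 1, c.2)) ∪
    cells.image fun c => (c.1, c.2 + 1)) ∪
    cells.image fun c => (c.1 + 1, c.2 + 1)

/-- The point of `ℝ²` corresponding to the node index `p`. -/
def nodePt (h1 h2 : ℝ) (p : ℤ × ℤ) : ℝ × ℝ := ((p.1 : ℝ) * h1, (p.2 : ℝ) * h2)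

/-- `Ω` is exactly tessellated by the cells of the Cartesian grid indexed by `cells`. -/
def IsTessellation (h1 h2 : ℝ) (cells : Finset (ℤ × ℤ)) (Ω : Set (ℝ × ℝ)) : Prop :=
  cells.Nonempty ∧ Ω = interior (⋃ c ∈ cells, cellC h1 h2 c) ∧
    closure Ω = ⋃ c ∈ cells, cellC h1 h2 c

/-- The edge basis function `φ_{s,n}` associated with the horizontal edge `e`. -/
def phiEdgeH (κ h1 h2 : ℝ) (cells : Finset (ℤ × ℤ)) (e : ℤ × ℤ) (n : ℕ) : ℝ × ℝ → ℂ :=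
  fun x =>
    if e ∈ cells ∧ x ∈ cellC h1 h2 e then
      phiHat κ h1 h2 n (x.1 - (e.1 : ℝ) * h1, h2 + ((e.2 : ℝ) * h2 - x.2))
    else if (e.1, e.2 - 1) ∈ cells ∧ x ∈ cellC h1 h2 (e.1, e.2 - 1) then
      phiHat κ h1 h2 n (x.1 - (e.1 : ℝ) * h1, h2 - ((e.2 : ℝ) * h2 - x.2))
    else 0

/-- The edge basis function `φ_{s,n}` associated with the vertical edge `e`. -/
def phiEdgeV (κ h1 h2 : ℝ) (cells : Finset (ℤ × ℤ)) (e : ℤ × ℤ) (n : ℕ) : ℝ × ℝ → ℂ :=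
  fun x =>
    if e ∈ cells ∧ x ∈ cellC h1 h2 e then
      phiHat κ h2 h1 n (x.2 - (e.2 : ℝ) * h2, h1 + ((e.1 : ℝ) * h1 - x.1))
    else if (e.1 - 1, e.2) ∈ cells ∧ x ∈ cellC h1 h2 (e.1 - 1, e.2) then
      phiHat κ h2 h1 n (x.2 - (e.2 : ℝ) * h2, h1 - ((e.1 : ℝ) * h1 - x.1))
    else 0

/-- The node basis function `ψ_{p,n}` associated with the node `p`. -/
def psiNode (κ h1 h2 : ℝ) (p : ℤ × ℤ) (n : ℕ) : ℝ × ℝ → ℂ :=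
  fun x =>
    if x ∈ Icc (((p.1 : ℝ) - 1) * h1) (((p.1 : ℝ) + 1) * h1) ×ˢ
        Icc ((p.2 : ℝ) * h2) (((p.2 : ℝ) + 1) * h2) then
      phiHat κ (2 * h1) h2 (2 * n - 1) (h1 - ((p.1 : ℝ) * h1 - x.1), h2 + ((p.2 : ℝ) * h2 - x.2))
    else if x ∈ Icc (((p.1 : ℝ) - 1) * h1) (((p.1 : ℝ) + 1) * h1) ×ˢ
        Icc (((p.2 : ℝ) - 1) * h2) ((p.2 : ℝ) * h2) then
      phiHat κ (2 * h1) h2 (2 * n - 1) (h1 - ((p.1 : ℝ) * h1 - x.1), h2 - ((p.2 : ℝ) * h2 - x.2))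
    else 0

/-- The set of edge basis functions with at most `Ne` modes per edge. -/
def edgeFuns (κ h1 h2 : ℝ) (cells : Finset (ℤ × ℤ)) (Ne : ℕ) : Set (ℝ × ℝ → ℂ) :=
  {f | ∃ e ∈ hEdges cells, ∃ n : ℕ, 1 ≤ n ∧ n ≤ Ne ∧ f = phiEdgeH κ h1 h2 cells e n} ∪
  {f | ∃ e ∈ vEdges cells, ∃ n : ℕ, 1 ≤ n ∧ n ≤ Ne ∧ f = phiEdgeV κ h1 h2 cells e n}

/-- The set of node basis functions with at most `Nn` modes per node. -/
def nodeFuns (κ h1 h2 : ℝ) (cells : Finset (ℤ × ℤ)) (Nn : ℕ) : Set (ℝ × ℝ → ℂ) :=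
  {f | ∃ p ∈ meshNodes cells, ∃ n : ℕ, 1 ≤ n ∧ n ≤ Nn ∧ f = psiNode κ h1 h2 p n}

/-- The edge-based Trefftz space `V_{N_e}(Σ_h)`. -/
def edgeSpace (κ h1 h2 : ℝ) (cells : Finset (ℤ × ℤ)) (Ne : ℕ) :
    Submodule ℂ (ℝ × ℝ → ℂ) :=
  Submodule.span ℂ (edgeFuns κ h1 h2 cells Ne)

/-- The combined edge-and-node Trefftz space `V_𝐍(T_h)`. -/
def combinedSpace (κ h1 h2 : ℝ) (cells : Finset (ℤ × ℤ)) (Ne Nn : ℕ) :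
    Submodule ℂ (ℝ × ℝ → ℂ) :=
  Submodule.span ℂ (edgeFuns κ h1 h2 cells Ne ∪ nodeFuns κ h1 h2 cells Nn)

/-- Square of the broken Sobolev norm `‖·‖²_{H^r_κ(T_h)}`. -/
def brokenNormSq (κ : ℝ) (r : ℕ) (h1 h2 : ℝ) (cells : Finset (ℤ × ℤ))
    (f : ℝ × ℝ → ℂ) : ℝ :=
  ∑ c ∈ cells, sobNormSq κ r (cellO h1 h2 c) f

/-- The global class `S^{N,M}_κ(T_h)`. -/
structure SGlob (κ h1 h2 : ℝ) (cells : Finset (ℤ × ℤ)) (Ω : Set (ℝ × ℝ)) (N M : ℕ)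
    (u : ℝ × ℝ → ℂ) : Prop where
  cont : ContinuousOn u (closure Ω)
  mem : ∀ c ∈ cells, MemSob 1 (cellO h1 h2 c) u
  helm : ∀ c ∈ cells, WeakHelmholtz κ (cellO h1 h2 c) u
  htraceReg : ∀ e ∈ hEdges cells,
    ContDiffOn ℝ M (fun t => u (t, (e.2 : ℝ) * h2)) (Icc ((e.1 : ℝ) * h1) (((e.1 : ℝ) + 1) * h1))
  hend : ∀ e ∈ hEdges cells, ∀ j < N,
    iteratedDerivWithin (2 * j) (fun t => u (t, (e.2 : ℝ) * h2))
        (Icc ((e.1 : ℝ) * h1) (((e.1 : ℝ) + 1) * h1)) ((e.1 : ℝ) * h1) = 0 ∧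
    iteratedDerivWithin (2 * j) (fun t => u (t, (e.2 : ℝ) * h2))
        (Icc ((e.1 : ℝ) * h1) (((e.1 : ℝ) + 1) * h1)) (((e.1 : ℝ) + 1) * h1) = 0
  vtraceReg : ∀ e ∈ vEdges cells,
    ContDiffOn ℝ M (fun t => u ((e.1 : ℝ) * h1, t)) (Icc ((e.2 : ℝ) * h2) (((e.2 : ℝ) + 1) * h2))
  vend : ∀ e ∈ vEdges cells, ∀ j < N,
    iteratedDerivWithin (2 * j) (fun t => u ((e.1 : ℝ) * h1, t))
        (Icc ((e.2 : ℝ) * h2) (((e.2 : ℝ) + 1) * h2)) ((e.2 : ℝ) * h2) = 0 ∧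
    iteratedDerivWithin (2 * j) (fun t => u ((e.1 : ℝ) * h1, t))
        (Icc ((e.2 : ℝ) * h2) (((e.2 : ℝ) + 1) * h2)) (((e.2 : ℝ) + 1) * h2) = 0

/-- Square of the skeleton seminorm `|u|²_{H^μ_κ(Σ_h)}`. -/
def skelSemiSq (κ h1 h2 : ℝ) (cells : Finset (ℤ × ℤ)) (μ : ℕ) (u : ℝ × ℝ → ℂ) : ℝ :=
  (∑ e ∈ hEdges cells, (κ ^ (2 * μ))⁻¹ *
    ∫ t in ((e.1 : ℝ) * h1)..(((e.1 : ℝ) + 1) * h1),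
      ‖iteratedDerivWithin μ (fun t => u (t, (e.2 : ℝ) * h2))
          (Icc ((e.1 : ℝ) * h1) (((e.1 : ℝ) + 1) * h1)) t‖ ^ 2) +
  ∑ e ∈ vEdges cells, (κ ^ (2 * μ))⁻¹ *
    ∫ t in ((e.2 : ℝ) * h2)..(((e.2 : ℝ) + 1) * h2),
      ‖iteratedDerivWithin μ (fun t => u ((e.1 : ℝ) * h1, t))
          (Icc ((e.2 : ℝ) * h2) (((e.2 : ℝ) + 1) * h2)) t‖ ^ 2

/-- `ν̃_n = (2n−1)π/(2κh₁)`. -/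
def nuTil (κ h1 : ℝ) (n : ℕ) : ℝ := (2 * (n : ℝ) - 1) * π / (2 * (κ * h1))

/-- `d̃`: distance to the node-associated propagative resonances. -/
def dTil (κ h1 h2 : ℝ) : ℝ :=
  sInf {d : ℝ | ∃ n : ℕ, 1 ≤ n ∧ nuTil κ h1 n < 1 ∧
    ∃ m : ℕ, d = |Real.sqrt (1 - nuTil κ h1 n ^ 2) - m * π / (κ * h2)|}

/-- `d̃₀`. -/
def dTil0 (κ h1 : ℝ) : ℝ :=
  sInf {d : ℝ | ∃ n : ℕ, 1 ≤ n ∧ 1 < nuTil κ h1 n ∧ d = Real.sqrt (nuTil κ h1 n ^ 2 - 1)}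

/-- `χ_N = min(ρe^{κh}/(κh), e·max(1,κh)^{2(N−1)})`. -/
def chiN (ρ kh : ℝ) (N : ℕ) : ℝ :=
  min (ρ * Real.exp kh / kh) (Real.exp 1 * max 1 kh ^ (2 * (N - 1)))


/-- Assumption A2: `κ² ∉ σ(2h₁,h₂)`. -/
def A2cond (κ h1 h2 : ℝ) : Prop := A0cond κ (2 * h1) h2

theorem pd1_iterate_mul (a b : ℝ → ℂ) (j : ℕ) :
    pd1^[j] (fun x => a x.1 * b x.2) = fun x => deriv^[j] a x.1 * b x.2 := by
  induction j generalizing a with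
  | zero => rfl
  | succ j ih =>
    rw [Function.iterate_succ_apply, Function.iterate_succ_apply, ← ih]
    congr 1
    funext x
    exact deriv_mul_const_field (u := a) (b x.2)

theorem pd2_iterate_mul (a b : ℝ → ℂ) (j : ℕ) :
    pd2^[j] (fun x => a x.1 * b x.2) = fun x => a x.1 * deriv^[j] b x.2 := by
  induction j generalizing b with
  | zero => rfl
  | succ j ih =>
    rw [Function.iterate_succ_apply, Function.iterate_succ_apply, ← ih]
    congr 1
    funext x
    exact deriv_const_mul_field (v := b) (a x.1)

theorem iterate_deriv_two_mul {f : ℝ → ℂ} {c : ℂ} (hf : deriv (deriv f) = fun t => c * f t)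
    (n : ℕ) : deriv^[2 * n] f = fun t => c ^ n * f t := by
  induction n with
  | zero => simp
  | succ n ih =>
    have key : ∀ (d : ℂ) (g : ℝ → ℂ), deriv (fun t => d * g t) = fun t => d * deriv g t :=
      fun d g => funext fun _ => deriv_const_mul_field _
    rw [show 2 * (n + 1) = 2 * n + 1 + 1 by ring, Function.iterate_succ_apply',
      Function.iterate_succ_apply', ih, key, key, hf]
    funext t
    ring

theorem eqOn_iterate_deriv {f g : ℝ → ℂ} {s : Set ℝ} (h : EqOn f g s) (hs : IsOpen s) (j : ℕ) :
    EqOn (deriv^[j] f) (deriv^[j] g) s := by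
  induction j with
  | zero => exact h
  | succ j ih =>
    rw [Function.iterate_succ_apply', Function.iterate_succ_apply']
    exact ih.deriv hs

theorem deriv_deriv_sin_mul (α β A : ℂ) :
    deriv (deriv fun t : ℝ => Complex.sin (α + β * t) * A) =
      fun t : ℝ => -β ^ 2 * (Complex.sin (α + β * t) * A) := by
  have hlin (t : ℝ) : HasDerivAt (fun s : ℝ => α + β * (s : ℂ)) β t := by
    simpa using (((hasDerivAt_id t).ofReal_comp).const_mul β).const_add α
  have h1 : (deriv fun t : ℝ => Complex.sin (α + β * t) * A) =
      fun t : ℝ => Complex.cos (α + β * t) * β * A :=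
    funext fun t => (((Complex.hasDerivAt_sin _).comp t (hlin t)).mul_const A).deriv
  rw [h1]
  funext t
  refine ((((Complex.hasDerivAt_cos _).comp t (hlin t)).mul_const β).mul_const A).deriv.trans ?_
  ring

theorem deriv_eq_zero_of_eqOn {f : ℝ → ℂ} {s : Set ℝ} {t : ℝ} (hs : UniqueDiffWithinAt ℝ s t)
    (ht : t ∈ s) (h : EqOn f 0 s) : deriv f t = 0 := by
  by_cases hd : DifferentiableAt ℝ f t
  · rw [← hd.derivWithin hs, derivWithin_congr h (h ht)]
    simp
  · exact deriv_zero_of_not_differentiableAt hd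

theorem eqOn_deriv_Iic {f : ℝ → ℂ} {a : ℝ} (h : EqOn f 0 (Iic a)) : EqOn (deriv f) 0 (Iic a) :=
  fun t ht => deriv_eq_zero_of_eqOn (uniqueDiffOn_Iic t t self_mem_Iic) self_mem_Iic
    (h.mono (Iic_subset_Iic.2 ht))

theorem eqOn_deriv_Ici {f : ℝ → ℂ} {a : ℝ} (h : EqOn f 0 (Ici a)) : EqOn (deriv f) 0 (Ici a) :=
  fun t ht => deriv_eq_zero_of_eqOn (uniqueDiffOn_Ici t t self_mem_Ici) self_mem_Ici
    (h.mono (Ici_subset_Ici.2 ht))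

/-- The classical second derivative of an eigenfunction of `d²/dt²` on `[a, b]` with homogeneous
Dirichlet values, extended by zero, is a multiple of the function, also at the end points. -/
theorem deriv_deriv_indicator_Icc {f : ℝ → ℂ} {a b : ℝ} {c : ℂ}
    (hf : deriv (deriv f) = fun t => c * f t) (ha : f a = 0) (hb : f b = 0) :
    deriv (deriv ((Icc a b).indicator f)) = fun t => c * (Icc a b).indicator f t := by
  have hl : EqOn ((Icc a b).indicator f) 0 (Iic a) := by
    intro t ht
    rcases (mem_Iic.1 ht).eq_or_lt with rfl | hlt
    · simp [indicator, ha]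
    · exact indicator_of_notMem (fun h => hlt.not_ge h.1) f
  have hr : EqOn ((Icc a b).indicator f) 0 (Ici b) := by
    intro t ht
    rcases (mem_Ici.1 ht).eq_or_lt with rfl | hlt
    · simp [indicator, hb]
    · exact indicator_of_notMem (fun h => hlt.not_ge h.2) f
  funext t
  rcases le_or_gt t a with hta | hta
  · rw [eqOn_deriv_Iic (eqOn_deriv_Iic hl) hta, hl hta]
    simp
  rcases le_or_gt b t with htb | htb
  · rw [eqOn_deriv_Ici (eqOn_deriv_Ici hr) htb, hr htb]
    simp
  have hi : EqOn ((Icc a b).indicator f) f (Ioo a b) :=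
    fun s hs => indicator_of_mem (Ioo_subset_Icc_self hs) f
  have h2 := (hi.deriv isOpen_Ioo).deriv isOpen_Ioo ⟨hta, htb⟩
  rw [h2, hf, hi ⟨hta, htb⟩]

theorem continuous_indicator_Icc {f : ℝ → ℂ} {a b : ℝ} (hab : a ≤ b) (hf : Continuous f)
    (ha : f a = 0) (hb : f b = 0) : Continuous ((Icc a b).indicator f) := by
  refine continuous_indicator (fun t ht => ?_) hf.continuousOn
  rw [frontier_Icc hab] at ht
  rcases ht with rfl | rfl
  exacts [ha, hb]

theorem csqrt_sq (r : ℝ) : csqrt r ^ 2 = r := by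
  simp [csqrt, ← Complex.cpow_nat_mul]

theorem sin_mul_csqrt_ne_zero {κ h1 h2 : ℝ} (hκ : 0 < κ) (hh1 : 0 < h1) (hh2 : 0 < h2)
    (hA : A0cond κ h1 h2) (k : ℕ) :
    Complex.sin ((h2 : ℂ) * (κ : ℂ) * csqrt (1 - nuHat κ h1 k ^ 2)) ≠ 0 := by
  intro h
  obtain ⟨j, hj⟩ := Complex.sin_eq_zero_iff.1 h
  have h2' := congrArg (· ^ 2) hj
  simp only [mul_pow, csqrt_sq] at h2'
  have h3 : h2 ^ 2 * κ ^ 2 * (1 - nuHat κ h1 k ^ 2) = (j : ℝ) ^ 2 * π ^ 2 := by exact_mod_cast h2'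
  have hj2 : ((j.natAbs : ℕ) : ℝ) ^ 2 = (j : ℝ) ^ 2 := by
    rw [Nat.cast_natAbs, Int.cast_abs, sq_abs]
  apply hA k j.natAbs
  rw [div_pow _ h2, mul_pow (j.natAbs : ℝ), hj2, ← h3, nuHat]
  field_simp
  ring

/-- The horizontal profile of `psiNode`. -/
def nodeProfile1 (κ h1 : ℝ) (i : ℤ) (m : ℕ) : ℝ → ℂ :=
  (Icc (((i : ℝ) - 1) * h1) (((i : ℝ) + 1) * h1)).indicator fun t =>
    Complex.sin (((κ * nuHat κ (2 * h1) (2 * m - 1) : ℝ) : ℂ) * ((h1 - (i * h1 - t) : ℝ) : ℂ))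

/-- The vertical profile of `psiNode`. -/
def nodeProfile2 (κ h1 h2 : ℝ) (j : ℤ) (m : ℕ) : ℝ → ℂ :=
  (Icc (((j : ℝ) - 1) * h2) (((j : ℝ) + 1) * h2)).indicator fun t =>
    Complex.sin (((h2 - |t - j * h2| : ℝ) : ℂ) * (κ : ℂ) *
        csqrt (1 - nuHat κ (2 * h1) (2 * m - 1) ^ 2)) /
      Complex.sin ((h2 : ℂ) * (κ : ℂ) * csqrt (1 - nuHat κ (2 * h1) (2 * m - 1) ^ 2))

theorem psiNode_eq_mul (κ h1 : ℝ) {h2 : ℝ} (hh2 : 0 < h2) (p : ℤ × ℤ) (m : ℕ) :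
    psiNode κ h1 h2 p m =
      fun x => nodeProfile1 κ h1 p.1 m x.1 * nodeProfile2 κ h1 h2 p.2 m x.2 := by
  funext x
  simp only [psiNode, nodeProfile1, nodeProfile2, indicator, mem_prod]
  by_cases h1x : x.1 ∈ Icc (((p.1 : ℝ) - 1) * h1) (((p.1 : ℝ) + 1) * h1)
  swap
  · simp [h1x]
  simp only [h1x, true_and, if_true]
  by_cases hu : x.2 ∈ Icc ((p.2 : ℝ) * h2) (((p.2 : ℝ) + 1) * h2)
  · have hm : x.2 ∈ Icc (((p.2 : ℝ) - 1) * h2) (((p.2 : ℝ) + 1) * h2) :=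
      ⟨by linarith [hu.1], hu.2⟩
    have : h2 - |x.2 - p.2 * h2| = h2 + (p.2 * h2 - x.2) := by
      rw [abs_of_nonneg (by linarith [hu.1])]; ring
    rw [if_pos hu, if_pos hm, phiHat, this, mul_div_assoc]
  by_cases hd : x.2 ∈ Icc (((p.2 : ℝ) - 1) * h2) ((p.2 : ℝ) * h2)
  · have hm : x.2 ∈ Icc (((p.2 : ℝ) - 1) * h2) (((p.2 : ℝ) + 1) * h2) :=
      ⟨hd.1, by linarith [hd.2]⟩
    have : h2 - |x.2 - p.2 * h2| = h2 - (p.2 * h2 - x.2) := by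
      rw [abs_of_nonpos (by linarith [hd.2])]; ring
    rw [if_neg hu, if_pos hd, if_pos hm, phiHat, this, mul_div_assoc]
  · have hm : x.2 ∉ Icc (((p.2 : ℝ) - 1) * h2) (((p.2 : ℝ) + 1) * h2) := by
      intro h
      rcases le_total (p.2 * h2) x.2 with h' | h'
      exacts [hu ⟨h', h.2⟩, hd ⟨h.1, h'⟩]
    rw [if_neg hu, if_neg hd, if_neg hm, mul_zero]

theorem mul_nuHat_eq {κ h1 : ℝ} (hκ : 0 < κ) (hh1 : 0 < h1) {m : ℕ} (hm : 1 ≤ m) :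
    κ * nuHat κ (2 * h1) (2 * m - 1) = (m * π - π / 2) / h1 := by
  rw [nuHat, Nat.cast_sub (by omega)]
  push_cast
  field_simp

theorem sin_mul_nuHat_mul_eq_zero {κ h1 : ℝ} (hκ : 0 < κ) (hh1 : 0 < h1) {m : ℕ} (hm : 1 ≤ m)
    {s : ℝ} (k : ℕ) (hs : s = k * (2 * h1)) :
    Complex.sin (((κ * nuHat κ (2 * h1) (2 * m - 1) : ℝ) : ℂ) * (s : ℂ)) = 0 := by
  rw [mul_nuHat_eq hκ hh1 hm, hs, ← Complex.ofReal_mul, ← Complex.ofReal_sin,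
    Complex.ofReal_eq_zero, Real.sin_eq_zero_iff]
  refine ⟨(2 * m - 1) * k, ?_⟩
  push_cast
  field_simp

theorem continuous_nodeProfile1 {κ h1 : ℝ} (hκ : 0 < κ) (hh1 : 0 < h1) (i : ℤ) {m : ℕ}
    (hm : 1 ≤ m) : Continuous (nodeProfile1 κ h1 i m) :=
  continuous_indicator_Icc (by nlinarith) (by fun_prop)
    (sin_mul_nuHat_mul_eq_zero hκ hh1 hm 0 (by push_cast; ring))
    (sin_mul_nuHat_mul_eq_zero hκ hh1 hm 1 (by push_cast; ring))

theorem iterate_deriv_nodeProfile1 {κ h1 : ℝ} (hκ : 0 < κ) (hh1 : 0 < h1) (i : ℤ) {m : ℕ}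
    (hm : 1 ≤ m) (n : ℕ) :
    deriv^[2 * n] (nodeProfile1 κ h1 i m) = fun t =>
      (-((κ * nuHat κ (2 * h1) (2 * m - 1) : ℝ) : ℂ) ^ 2) ^ n * nodeProfile1 κ h1 i m t := by
  refine iterate_deriv_two_mul (deriv_deriv_indicator_Icc ?_ ?_ ?_) n
  rotate_left
  · exact sin_mul_nuHat_mul_eq_zero hκ hh1 hm 0 (by push_cast; ring)
  · exact sin_mul_nuHat_mul_eq_zero hκ hh1 hm 1 (by push_cast; ring)
  have h := deriv_deriv_sin_mul
    (((κ * nuHat κ (2 * h1) (2 * m - 1) : ℝ) : ℂ) * ((h1 - i * h1 : ℝ) : ℂ))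
    ((κ * nuHat κ (2 * h1) (2 * m - 1) : ℝ) : ℂ) 1
  convert h using 4 <;> (push_cast; ring_nf)

theorem continuous_nodeProfile2 (κ h1 : ℝ) {h2 : ℝ} (hh2 : 0 < h2) (j : ℤ) (m : ℕ) :
    Continuous (nodeProfile2 κ h1 h2 j m) := by
  refine continuous_indicator_Icc (by nlinarith) (by fun_prop) ?_ ?_
  · have : h2 - |((j : ℝ) - 1) * h2 - j * h2| = 0 := by
      rw [abs_of_nonpos (by linarith)]; ring
    simp [this]
  · have : h2 - |((j : ℝ) + 1) * h2 - j * h2| = 0 := by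
      rw [abs_of_nonneg (by linarith)]; ring
    simp [this]

/-- On each open grid interval the vertical profile is a sine, or zero. -/
theorem nodeProfile2_eqOn_sin (κ h1 : ℝ) {h2 : ℝ} (hh2 : 0 < h2) (j : ℤ) (m : ℕ) (c : ℤ) :
    ∃ α β A : ℂ, β ^ 2 = (κ * csqrt (1 - nuHat κ (2 * h1) (2 * m - 1) ^ 2)) ^ 2 ∧
      EqOn (nodeProfile2 κ h1 h2 j m) (fun t : ℝ => Complex.sin (α + β * t) * A)
        (Ioo ((c : ℝ) * h2) (((c : ℝ) + 1) * h2)) := by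
  set μ : ℂ := κ * csqrt (1 - nuHat κ (2 * h1) (2 * m - 1) ^ 2) with hμ
  rcases lt_trichotomy c j with hc | rfl | hc
  · have hcj : (c : ℝ) + 1 ≤ j := by exact_mod_cast hc
    rcases hcj.eq_or_lt with he | hlt
    · refine ⟨(h2 - j * h2) * μ, μ, (Complex.sin (h2 * μ))⁻¹, rfl, fun t ht => ?_⟩
      rw [he, show (c : ℝ) = j - 1 by linarith] at ht
      rw [nodeProfile2, indicator_of_mem (mem_Icc.2 ⟨ht.1.le, by linarith [ht.2]⟩),
        abs_of_nonpos (by linarith [ht.2]), div_eq_mul_inv, mul_assoc, mul_assoc, ← hμ]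
      push_cast
      ring_nf
    · refine ⟨0, μ, 0, rfl, fun t ht => ?_⟩
      have hlt' : (c : ℝ) + 1 ≤ j - 1 := by
        have : c + 1 < j := by exact_mod_cast hlt
        have : c + 1 ≤ j - 1 := by omega
        exact_mod_cast this
      rw [nodeProfile2, indicator_of_notMem]
      · exact (mul_zero _).symm
      intro h
      nlinarith [h.1, ht.2]
  · refine ⟨(h2 + c * h2) * μ, -μ, (Complex.sin (h2 * μ))⁻¹, neg_sq μ, fun t ht => ?_⟩
    rw [nodeProfile2, indicator_of_mem (mem_Icc.2 ⟨by linarith [ht.1], ht.2.le⟩),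
      abs_of_nonneg (by linarith [ht.1]), div_eq_mul_inv, mul_assoc, mul_assoc, ← hμ]
    push_cast
    ring_nf
  · refine ⟨0, μ, 0, rfl, fun t ht => ?_⟩
    have hjc : (j : ℝ) + 1 ≤ c := by exact_mod_cast hc
    rw [nodeProfile2, indicator_of_notMem]
    · exact (mul_zero _).symm
    intro h
    nlinarith [h.2, ht.1]

theorem eqOn_iterate_deriv_nodeProfile2 (κ h1 : ℝ) {h2 : ℝ} (hh2 : 0 < h2) (j : ℤ) (m : ℕ)
    (c : ℤ) (n : ℕ) :
    EqOn (deriv^[2 * n] (nodeProfile2 κ h1 h2 j m))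
      (fun t => (-(κ * csqrt (1 - nuHat κ (2 * h1) (2 * m - 1) ^ 2)) ^ 2) ^ n *
        nodeProfile2 κ h1 h2 j m t)
      (Ioo ((c : ℝ) * h2) (((c : ℝ) + 1) * h2)) := by
  obtain ⟨α, β, A, hβ, h⟩ := nodeProfile2_eqOn_sin κ h1 hh2 j m c
  intro t ht
  rw [eqOn_iterate_deriv h isOpen_Ioo _ ht,
    iterate_deriv_two_mul (deriv_deriv_sin_mul α β A), ← hβ]
  simp only [h ht]

theorem nodeProfile1_node {κ h1 : ℝ} (hκ : 0 < κ) (hh1 : 0 < h1) (i k : ℤ) {m : ℕ}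
    (hm : 1 ≤ m) :
    nodeProfile1 κ h1 i m (k * h1) = if i = k then -(-1 : ℂ) ^ m else 0 := by
  rcases eq_or_ne i k with rfl | hik
  · rw [if_pos rfl, nodeProfile1, indicator_of_mem (mem_Icc.2 ⟨by linarith, by linarith⟩),
      mul_nuHat_eq hκ hh1 hm, ← Complex.ofReal_mul, ← Complex.ofReal_sin, sub_self, sub_zero,
      div_mul_cancel₀ _ hh1.ne', Real.sin_sub_pi_div_two, Real.cos_nat_mul_pi]
    push_cast
    rfl
  rw [if_neg hik]
  by_cases hmem : (k : ℝ) * h1 ∈ Icc (((i : ℝ) - 1) * h1) (((i : ℝ) + 1) * h1)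
  swap
  · exact indicator_of_notMem hmem _
  rw [nodeProfile1, indicator_of_mem hmem]
  have hl : i - 1 ≤ k := by exact_mod_cast le_of_mul_le_mul_right hmem.1 hh1
  have hr : k ≤ i + 1 := by exact_mod_cast le_of_mul_le_mul_right hmem.2 hh1
  obtain rfl | rfl : k = i - 1 ∨ k = i + 1 := by omega
  · exact sin_mul_nuHat_mul_eq_zero hκ hh1 hm 0 (by push_cast; ring)
  · exact sin_mul_nuHat_mul_eq_zero hκ hh1 hm 1 (by push_cast; ring)

theorem nodeProfile2_node {κ h1 h2 : ℝ} (hκ : 0 < κ) (hh1 : 0 < h1) (hh2 : 0 < h2)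
    (hA2 : A2cond κ h1 h2) (j k : ℤ) (m : ℕ) :
    nodeProfile2 κ h1 h2 j m (k * h2) = if j = k then 1 else 0 := by
  rcases eq_or_ne j k with rfl | hjk
  · rw [if_pos rfl, nodeProfile2, indicator_of_mem (mem_Icc.2 ⟨by linarith, by linarith⟩), sub_self,
      abs_zero, sub_zero]
    exact div_self (sin_mul_csqrt_ne_zero hκ (by linarith) hh2 hA2 _)
  rw [if_neg hjk]
  by_cases hmem : (k : ℝ) * h2 ∈ Icc (((j : ℝ) - 1) * h2) (((j : ℝ) + 1) * h2)
  swap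
  · exact indicator_of_notMem hmem _
  rw [nodeProfile2, indicator_of_mem hmem]
  have hl : j - 1 ≤ k := by exact_mod_cast le_of_mul_le_mul_right hmem.1 hh2
  have hr : k ≤ j + 1 := by exact_mod_cast le_of_mul_le_mul_right hmem.2 hh2
  have : h2 - |(k : ℝ) * h2 - j * h2| = 0 := by
    obtain rfl | rfl : k = j - 1 ∨ k = j + 1 := by omega
    · push_cast
      rw [abs_of_nonpos (by linarith)]
      ring
    · push_cast
      rw [abs_of_nonneg (by linarith)]
      ring
  simp [this]

/-- Lemma 4.4: under Assumption A2, the even-order partial derivatives of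
the node basis functions extend continuously to `closure Ω` (the extension agreeing with the
classical derivative on every open cell), and
`(κ⁻¹∂₁)^{2n}ψ_{p,m}(q) = −δ_{pq}(−1)^{n+m} ν̃_m^{2n}` at every node `q`. -/
theorem node_basis_properties (κ h1 h2 : ℝ) (hκ : 0 < κ) (hh1 : 0 < h1) (hh2 : 0 < h2)
    (cells : Finset (ℤ × ℤ)) (Ω : Set (ℝ × ℝ)) (hT : IsTessellation h1 h2 cells Ω)
    (hA2 : A2cond κ h1 h2) (n : ℕ) (m : ℕ) (hm : 1 ≤ m)
    (p : ℤ × ℤ) (hp : p ∈ meshNodes cells) :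
    (∃ g : ℝ × ℝ → ℂ, ContinuousOn g (closure Ω) ∧
      ∀ c ∈ cells, EqOn g (pdM (2 * n) 0 (psiNode κ h1 h2 p m)) (cellO h1 h2 c)) ∧
    (∃ g : ℝ × ℝ → ℂ, ContinuousOn g (closure Ω) ∧
      ∀ c ∈ cells, EqOn g (pdM 0 (2 * n) (psiNode κ h1 h2 p m)) (cellO h1 h2 c)) ∧
    ∀ q : ℤ × ℤ, q ∈ meshNodes cells →
      ((κ : ℂ)⁻¹) ^ (2 * n) * pdM (2 * n) 0 (psiNode κ h1 h2 p m) (nodePt h1 h2 q) =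
        -(if p = q then 1 else 0) * (-1 : ℂ) ^ (n + m) *
          ((nuTil κ h1 m : ℝ) : ℂ) ^ (2 * n) := by
  have hψ := psiNode_eq_mul κ h1 hh2 p m
  have hcont : Continuous (psiNode κ h1 h2 p m) := by
    rw [hψ]
    exact ((continuous_nodeProfile1 hκ hh1 p.1 hm).comp continuous_fst).mul
      ((continuous_nodeProfile2 κ h1 hh2 p.2 m).comp continuous_snd)
  have hpd1 : pdM (2 * n) 0 (psiNode κ h1 h2 p m) = fun x =>
      (-((κ * nuHat κ (2 * h1) (2 * m - 1) : ℝ) : ℂ) ^ 2) ^ n * psiNode κ h1 h2 p m x := by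
    simp only [pdM, Function.iterate_zero, id_eq, hψ, pd1_iterate_mul,
      iterate_deriv_nodeProfile1 hκ hh1 p.1 hm n, mul_assoc]
  refine ⟨⟨_, ?_, fun _ _ => eqOn_refl _ _⟩,
    ⟨fun x => (-(κ * csqrt (1 - nuHat κ (2 * h1) (2 * m - 1) ^ 2)) ^ 2) ^ n *
      psiNode κ h1 h2 p m x, (continuous_const.mul hcont).continuousOn, fun c _ x hx => ?_⟩,
    fun q _ => ?_⟩
  · rw [hpd1]
    exact (continuous_const.mul hcont).continuousOn
  · simp only [pdM, Function.iterate_zero, id_eq, hψ, pd2_iterate_mul]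
    rw [eqOn_iterate_deriv_nodeProfile2 κ h1 hh2 p.2 m c.2 n hx.2]
    ring
  · have hval : psiNode κ h1 h2 p m (nodePt h1 h2 q) = -(if p = q then 1 else 0) * (-1) ^ m := by
      rw [hψ]
      simp only [nodePt, nodeProfile1_node hκ hh1 _ _ hm, nodeProfile2_node hκ hh1 hh2 hA2,
        Prod.ext_iff]
      by_cases h₁ : p.1 = q.1 <;> by_cases h₂ : p.2 = q.2 <;> simp [h₁, h₂]
    have hν : nuHat κ (2 * h1) (2 * m - 1) = nuTil κ h1 m := by
      rw [nuHat, nuTil, Nat.cast_sub (by omega)]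
      push_cast
      ring_nf
    have hκ' : (κ : ℂ) ≠ 0 := by exact_mod_cast hκ.ne'
    rw [hpd1]
    simp only [hval, hν]
    have hc : ((κ : ℂ)⁻¹) ^ (2 * n) * (-((κ * nuTil κ h1 m : ℝ) : ℂ) ^ 2) ^ n =
        (-1) ^ n * ((nuTil κ h1 m : ℝ) : ℂ) ^ (2 * n) := by
      rw [pow_mul, pow_mul, ← mul_pow, ← mul_pow]
      congr 1
      push_cast
      field_simp
    rw [← mul_assoc, hc, pow_add]
    ring

end
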